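/- Let x be the horizontal component of the Peano curve, and let p = p'/q' where p' and q' are positive integers not divisible by 3. Then for every t ∈ [0,1], lim_{n→∞} 3^{-n}p · TV^{3^{-n}p}(x,[0,t]) = C_p · t, where C_p = 3^{⌊-log₃ p⌋}·p·(1 - (3/4)·3^{⌊-log₃ p⌋}·p). -/

import Mathlib

open scoped BigOperators Classical
open Filter

noncomputable section

/-- The digit map `k n = 2 - n` on `{0,1,2}` (with truncated natural subtraction). -/
def peanoK : ℕ → ℕ := fun n => 2 - n

/-- The `m`-th (0-indexed) ternary digit of the horizontal component of the Peano curve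
evaluated at the point with ternary digits `d` (0-indexed, i.e. `t_j = d (j-1)`):
the `j`-th digit of `x(t)` is `k^[t_2 + t_4 + ⋯ + t_{2j-2}] (t_{2j-1})`. -/
def peanoXDigit (d : ℕ → Fin 3) (m : ℕ) : ℕ :=
  peanoK^[∑ i ∈ Finset.range m, (d (2 * i + 1) : ℕ)] (d (2 * m) : ℕ)

/-- `x : ℝ → ℝ` is (on `[0,1]`) the horizontal component of the Peano curve:
for every ternary expansion `t = Σ_j d_j 3^{-(j+1)}`, `x t` is given by the digit formula. -/
def IsPeanoX (x : ℝ → ℝ) : Prop :=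
  ∀ d : ℕ → Fin 3,
    x (∑' j : ℕ, (d j : ℝ) / 3 ^ (j + 1)) = ∑' m : ℕ, (peanoXDigit d m : ℝ) / 3 ^ (m + 1)

/-- The grid `cℤ + r = {cq + r : q ∈ ℤ}`. -/
def peanoGrid (c r : ℝ) : Set ℝ := {u : ℝ | ∃ q : ℤ, u = c * q + r}

/-- `lebTime x c r m` is the time `t_{m+1}(c,r)` of the Lebesgue partition `π(c,r)` for `x`
on `[0,1]` (values in `[0,1] ∪ {+∞}`, modelled in `EReal`; `sInf ∅ = ⊤ = +∞`). -/
def lebTime (x : ℝ → ℝ) (c r : ℝ) : ℕ → EReal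
  | 0 => sInf (Real.toEReal '' {t : ℝ | t ∈ Set.Icc (0 : ℝ) 1 ∧ x t ∈ peanoGrid c r})
  | m + 1 =>
    if lebTime x c r m = ⊤ then ⊤
    else
      sInf (Real.toEReal ''
        {t : ℝ | t ∈ Set.Icc ((lebTime x c r m).toReal) 1 ∧ x t ∈ peanoGrid c r ∧
          x t ≠ x ((lebTime x c r m).toReal)})

/-- `k(c,r,t) = min{m ∈ ℕ₊ : t_m(c,r) ≥ t}` (recall `t_m(c,r) = lebTime x c r (m-1)`). -/
def kIdx (x : ℝ → ℝ) (c r t : ℝ) : ℕ :=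
  sInf {m : ℕ | 1 ≤ m ∧ (t : EReal) ≤ lebTime x c r (m - 1)}

/-- `l(c,r,t) = max{m ∈ ℕ₊ : t_m(c,r) ≤ t}`. -/
def lIdx (x : ℝ → ℝ) (c r t : ℝ) : ℕ :=
  sSup {m : ℕ | 1 ≤ m ∧ lebTime x c r (m - 1) ≤ (t : EReal)}

/-- The quadratic variation `[x]_{s,t}^{c,r}` of `x` on `[s,t]` along the Lebesgue partition
`π(c,r)`: the sum over `m = k(c,r,s), …, l(c,r,t) - 1` of `(x(t_{m+1}) - x(t_m))²`. -/
def qvar (x : ℝ → ℝ) (c r s t : ℝ) : ℝ :=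
  ∑ m ∈ Finset.Ico (kIdx x c r s) (lIdx x c r t),
    (x ((lebTime x c r m).toReal) - x ((lebTime x c r (m - 1)).toReal)) ^ 2

/-- `[x]_t^{c,r} := [x]_{0,t}^{c,r}`. -/
def qvar0 (x : ℝ → ℝ) (c r t : ℝ) : ℝ := qvar x c r 0 t

/-- The truncated variation `TV^c(x,[s,t])`: the supremum over all finite partitions
`s = u_0 ≤ u_1 ≤ ⋯ ≤ u_m = t` of `Σ_i max(|x(u_{i+1}) - x(u_i)| - c, 0)`. -/
def truncVar (x : ℝ → ℝ) (c s t : ℝ) : ℝ :=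
  sSup {v : ℝ | ∃ (m : ℕ) (u : ℕ → ℝ), u 0 = s ∧ u m = t ∧ (∀ i, i < m → u i ≤ u (i + 1)) ∧
    v = ∑ i ∈ Finset.range m, max (|x (u (i + 1)) - x (u i)| - c) 0}

/-! ### One-step self-similarity of the horizontal component -/

theorem peanoXDigit_lt (d : ℕ → Fin 3) (m : ℕ) : peanoXDigit d m < 3 := by
  unfold peanoXDigit
  generalize (∑ i ∈ Finset.range m, (d (2 * i + 1) : ℕ)) = n
  cases n with
  | zero => exact (d (2 * m)).isLt
  | succ n =>
    rw [Function.iterate_succ_apply']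
    simp only [peanoK]
    omega

/-- The ternary digits of the horizontal component, as elements of `Fin 3`. -/
def peanoDigits (d : ℕ → Fin 3) (m : ℕ) : Fin 3 := ⟨peanoXDigit d m, peanoXDigit_lt d m⟩

theorem IsPeanoX.apply_ofDigits {x : ℝ → ℝ} (hx : IsPeanoX x) (d : ℕ → Fin 3) :
    x (Real.ofDigits d) = Real.ofDigits (peanoDigits d) := by
  simpa [Real.ofDigits, Real.ofDigitsTerm, div_eq_mul_inv, peanoDigits] using hx d

theorem exists_ofDigits_eq {s : ℝ} (hs : s ∈ Set.Icc (0 : ℝ) 1) :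
    ∃ d : ℕ → Fin 3, Real.ofDigits d = s := by
  obtain ⟨d, -, hd⟩ := Real.ofDigits_SurjOn (b := 3) (by norm_num) hs
  exact ⟨d, hd⟩

theorem ofDigits_rev (e : ℕ → Fin 3) :
    Real.ofDigits (fun m => Fin.rev (e m)) = 1 - Real.ofDigits e := by
  have h1 : Real.ofDigits (fun _ : ℕ => (2 : Fin 3)) = 1 := Real.ofDigits_const_last_eq_one 2
  rw [eq_sub_iff_add_eq, ← h1]
  unfold Real.ofDigits
  rw [← Real.summable_ofDigitsTerm.tsum_add Real.summable_ofDigitsTerm]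
  congr 1
  ext m
  simp only [Real.ofDigitsTerm]
  rw [← add_mul]
  congr 1
  generalize e m = a
  fin_cases a <;> norm_num [Fin.rev]

/-- Prepending the digits `i`, `j` to a ternary expansion. -/
def consTwo (i j : Fin 3) (d : ℕ → Fin 3) : ℕ → Fin 3
  | 0 => i
  | 1 => j
  | n + 2 => d n

theorem ofDigits_consTwo (i j : Fin 3) (d : ℕ → Fin 3) :
    Real.ofDigits (consTwo i j d) = (3 * (i : ℕ) + (j : ℕ) + Real.ofDigits d) / 9 := by
  rw [Real.ofDigits_eq_sum_add_ofDigits _ 2]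
  have : (fun n => consTwo i j d (n + 2)) = d := rfl
  simp [Finset.sum_range_succ, Real.ofDigitsTerm, consTwo]
  ring

theorem peanoK_peanoK {n : ℕ} (hn : n < 3) : peanoK (peanoK n) = n := by
  unfold peanoK; omega

theorem peanoXDigit_consTwo_succ (i j : Fin 3) (d : ℕ → Fin 3) (m : ℕ) :
    peanoXDigit (consTwo i j d) (m + 1) = peanoK^[(j : ℕ)] (peanoXDigit d m) := by
  unfold peanoXDigit
  rw [Finset.sum_range_succ', add_comm, Function.iterate_add_apply]
  rfl

theorem ofDigits_peanoDigits_consTwo (i j : Fin 3) (d : ℕ → Fin 3) :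
    Real.ofDigits (peanoDigits (consTwo i j d)) =
      ((i : ℕ) + if j = 1 then 1 - Real.ofDigits (peanoDigits d)
        else Real.ofDigits (peanoDigits d)) / 3 := by
  rw [Real.ofDigits_eq_sum_add_ofDigits _ 1]
  have h : (fun m => peanoDigits (consTwo i j d) (m + 1)) =
      if j = 1 then (fun m => Fin.rev (peanoDigits d m)) else peanoDigits d := by
    ext m
    have hlt := peanoXDigit_lt d m
    have h2 := peanoK_peanoK hlt
    simp only [peanoDigits, peanoXDigit_consTwo_succ]
    fin_cases j
    · simp [peanoDigits]
    · simp [peanoK, Fin.rev]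
    · simpa [peanoDigits] using h2
  have h0 : peanoDigits (consTwo i j d) 0 = i := by
    simp [peanoDigits, peanoXDigit, consTwo]
  rw [h]
  simp only [Finset.sum_range_one, Real.ofDigitsTerm, h0]
  split_ifs
  · rw [ofDigits_rev]; ring
  · ring

namespace IsPeanoX

variable {x : ℝ → ℝ}

theorem apply_block (hx : IsPeanoX x) (i j : Fin 3) {s : ℝ} (hs : s ∈ Set.Icc (0 : ℝ) 1) :
    x ((3 * (i : ℕ) + (j : ℕ) + s) / 9) = ((i : ℕ) + if j = 1 then 1 - x s else x s) / 3 := by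
  obtain ⟨d, rfl⟩ := exists_ofDigits_eq hs
  rw [← ofDigits_consTwo, hx.apply_ofDigits, hx.apply_ofDigits, ofDigits_peanoDigits_consTwo]

theorem mem_Icc (hx : IsPeanoX x) {s : ℝ} (hs : s ∈ Set.Icc (0 : ℝ) 1) :
    x s ∈ Set.Icc (0 : ℝ) 1 := by
  obtain ⟨d, rfl⟩ := exists_ofDigits_eq hs
  rw [hx.apply_ofDigits]
  exact ⟨Real.ofDigits_nonneg _, Real.ofDigits_le_one _⟩

theorem apply_zero (hx : IsPeanoX x) : x 0 = 0 := by
  have := hx.apply_block 0 0 (s := 0) (by simp)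
  norm_num at this
  linarith

theorem apply_one (hx : IsPeanoX x) : x 1 = 1 := by
  have := hx.apply_block 2 2 (s := 1) (by simp)
  rw [if_neg (by decide)] at this
  norm_num at this
  linarith

theorem exists_block {s : ℝ} (hs : s ∈ Set.Icc (0 : ℝ) 1) :
    ∃ (i j : Fin 3), ∃ r ∈ Set.Icc (0 : ℝ) 1, s = (3 * (i : ℕ) + (j : ℕ) + r) / 9 := by
  obtain ⟨d, rfl⟩ := exists_ofDigits_eq hs
  refine ⟨d 0, d 1, Real.ofDigits fun n => d (n + 2),
    ⟨Real.ofDigits_nonneg _, Real.ofDigits_le_one _⟩, ?_⟩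
  rw [← ofDigits_consTwo]
  congr 1
  ext n
  match n with
  | 0 => rfl
  | 1 => rfl
  | n + 2 => rfl

/-- On the `i`-th third of `[0,1]` the curve stays in the `i`-th third of `[0,1]`. -/
theorem mem_third (hx : IsPeanoX x) {i : ℕ} (hi : i < 3) {s : ℝ}
    (hs : s ∈ Set.Icc ((i : ℝ) / 3) ((i + 1) / 3)) :
    x s ∈ Set.Icc ((i : ℝ) / 3) ((i + 1) / 3) := by
  obtain ⟨h1, h2⟩ := hs
  suffices ∃ j : Fin 3, 9 * s - 3 * i - (j : ℕ) ∈ Set.Icc (0 : ℝ) 1 by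
    obtain ⟨j, hj⟩ := this
    have hb := hx.apply_block ⟨i, hi⟩ j hj
    have hm := hx.mem_Icc hj
    have e : (3 * (i : ℝ) + (j : ℕ) + (9 * s - 3 * i - (j : ℕ))) / 9 = s := by ring
    simp only [e] at hb
    rw [hb]
    obtain ⟨hm1, hm2⟩ := hm
    split_ifs <;> constructor <;> linarith
  rcases le_total (9 * s) (3 * i + 1) with h | h
  · exact ⟨0, by constructor <;> norm_num <;> linarith⟩
  rcases le_total (9 * s) (3 * i + 2) with h' | h'
  · exact ⟨1, by constructor <;> norm_num <;> linarith⟩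
  · exact ⟨2, by constructor <;> norm_num <;> linarith⟩

theorem sub_le_third (hx : IsPeanoX x) {s r : ℝ} (hs : 0 ≤ s) (hsr : s ≤ r) (hr : r ≤ 1) :
    x s - x r ≤ 1 / 3 := by
  have third : ∀ u ∈ Set.Icc (0 : ℝ) 1, ∃ i : ℕ, i < 3 ∧ u ∈ Set.Icc ((i : ℝ) / 3) ((i + 1 : ℝ) / 3) := by
    rintro u ⟨h0, h1⟩
    rcases le_total u (1 / 3) with h | h
    · exact ⟨0, by norm_num, by constructor <;> norm_num <;> linarith⟩
    rcases le_total u (2 / 3) with h' | h'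
    · exact ⟨1, by norm_num, by constructor <;> norm_num <;> linarith⟩
    · exact ⟨2, by norm_num, by constructor <;> norm_num <;> linarith⟩
  obtain ⟨i, hi, his⟩ := third s ⟨hs, hsr.trans hr⟩
  obtain ⟨k, hk, hkr⟩ := third r ⟨hs.trans hsr, hr⟩
  have h1 := (hx.mem_third hi his).2
  have h2 := (hx.mem_third hk hkr).1
  rcases le_or_gt i k with hik | hik
  · have : (i : ℝ) ≤ k := by exact_mod_cast hik
    linarith
  · have : (k : ℝ) + 1 ≤ i := by exact_mod_cast hik
    have : s = r := by linarith [his.1, hkr.2]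
    rw [this]
    norm_num

end IsPeanoX

/-! ### Truncated variation sums along partitions -/

/-- `PartitionSum x c a b v`: `v` is the `c`-truncated variation sum of `x` along some finite
partition of `[a,b]`. -/
inductive PartitionSum (x : ℝ → ℝ) (c a : ℝ) : ℝ → ℝ → Prop
  | refl : PartitionSum x c a a 0
  | snoc {b d v : ℝ} : PartitionSum x c a b v → b ≤ d →
      PartitionSum x c a d (v + max (|x d - x b| - c) 0)

namespace PartitionSum

variable {x : ℝ → ℝ} {c a b d v w K V W : ℝ}

theorem le (h : PartitionSum x c a b v) : a ≤ b := by
  induction h with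
  | refl => exact le_rfl
  | snoc _ hbd ih => exact ih.trans hbd

theorem single (hab : a ≤ b) : PartitionSum x c a b (0 + max (|x b - x a| - c) 0) :=
  refl.snoc hab

theorem trans (h : PartitionSum x c a b v) (h' : PartitionSum x c b d w) :
    PartitionSum x c a d (v + w) := by
  induction h' with
  | refl => simpa using h
  | snoc _ hbd ih => rw [← add_assoc]; exact ih.snoc hbd

/-- Splitting a partition at `b`, at a cost of at most `K`. -/
theorem exists_split (hK : 0 ≤ K)
    (hb : ∀ u ∈ Set.Icc a b, ∀ r ∈ Set.Icc b d, max (|x r - x u| - c) 0 ≤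
      max (|x b - x u| - c) 0 + max (|x r - x b| - c) 0 + K)
    (hab : a ≤ b) (h : PartitionSum x c a d v) (hbd : b ≤ d) :
    ∃ v₁ v₂, PartitionSum x c a b v₁ ∧ PartitionSum x c b d v₂ ∧ v ≤ v₁ + v₂ + K := by
  suffices H : ∀ e v, PartitionSum x c a e v → e ≤ d → b ≤ e →
      ∃ v₁ v₂, PartitionSum x c a b v₁ ∧ PartitionSum x c b e v₂ ∧ v ≤ v₁ + v₂ + K from
    H d v h le_rfl hbd
  intro e _ h
  induction h with
  | refl =>
    intro _ hba
    obtain rfl := le_antisymm hab hba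
    exact ⟨0, 0, refl, refl, by linarith⟩
  | @snoc f e v hf hfe ih =>
    intro hed hbe
    rcases le_total b f with hbf | hfb
    · obtain ⟨v₁, v₂, h₁, h₂, hv⟩ := ih (hfe.trans hed) hbf
      exact ⟨v₁, _, h₁, h₂.snoc hfe, by linarith⟩
    · exact ⟨_, _, hf.snoc hfb, single hbe,
        by linarith [hb f ⟨hf.le, hfb⟩ e ⟨hbe, hed⟩]⟩

end PartitionSum

/-- `V` bounds all `c`-truncated variation sums of `x` on `[a,b]`. -/
def PartitionBound (x : ℝ → ℝ) (c a b V : ℝ) : Prop := ∀ v, PartitionSum x c a b v → v ≤ V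

namespace PartitionBound

variable {x : ℝ → ℝ} {c a b d v w K V W : ℝ}

theorem self (hc : 0 ≤ c) : PartitionBound x c a a 0 := by
  suffices H : ∀ e v, PartitionSum x c a e v → e ≤ a → v ≤ 0 from fun v hv => H a v hv le_rfl
  intro e _ h
  induction h with
  | refl => exact fun _ => le_rfl
  | @snoc f e v hf hfe ih =>
    intro hea
    obtain rfl : f = e := le_antisymm hfe (hea.trans hf.le)
    simpa [hc] using ih hea

theorem mono_right (h : PartitionBound x c a d V) (hbd : b ≤ d) : PartitionBound x c a b V :=
  fun _ hv => (le_add_of_nonneg_right (le_max_right _ _)).trans (h _ (hv.snoc hbd))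

theorem mono (h : PartitionBound x c a b V) (hVW : V ≤ W) : PartitionBound x c a b W :=
  fun v hv => (h v hv).trans hVW

theorem trans (hc : 0 ≤ c) (hab : a ≤ b) (hbd : b ≤ d) (h : PartitionBound x c a b V)
    (h' : PartitionBound x c b d W) : PartitionBound x c a d (V + W + c) := by
  intro v hv
  obtain ⟨v₁, v₂, h₁, h₂, hv⟩ := hv.exists_split hc (b := b) (by
    intro u _ r _
    have := abs_sub_le (x r) (x b) (x u)
    rcases max_cases (|x b - x u| - c) 0 with h | h <;>
      rcases max_cases (|x r - x b| - c) 0 with h' | h' <;>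
      refine max_le ?_ ?_ <;> linarith) hab hbd
  linarith [h _ h₁, h' _ h₂]

/-- At an extremum of `x` on `[a,d]` the truncated variation is additive. -/
theorem trans_of_extremum (hab : a ≤ b) (hbd : b ≤ d)
    (hb : ∀ u ∈ Set.Icc a b, ∀ r ∈ Set.Icc b d, 0 ≤ (x b - x u) * (x b - x r))
    (h : PartitionBound x c a b V) (h' : PartitionBound x c b d W) :
    PartitionBound x c a d (V + W) := by
  intro v hv
  obtain ⟨v₁, v₂, h₁, h₂, hv⟩ := hv.exists_split le_rfl (b := b) (by
    intro u hu r hr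
    have h1 := le_max_left (|x b - x u| - c) 0
    have h2 := le_max_left (|x r - x b| - c) 0
    have h3 := le_max_right (|x b - x u| - c) 0
    have h4 := le_max_right (|x r - x b| - c) 0
    have : |x r - x u| ≤ |x b - x u| ∨ |x r - x u| ≤ |x r - x b| := by
      have key := hb u hu r hr
      rw [← sq_le_sq, ← sq_le_sq]
      by_contra! H
      nlinarith [H.1, H.2]
    refine max_le ?_ (by linarith)
    rcases this with h | h <;> linarith) hab hbd
  linarith [h _ h₁, h' _ h₂]

/-- A path that rises from `0` to `H` with all drops at most `c ≤ H` has truncated variation at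
most `H - c`. -/
theorem of_drop_le {y : ℝ → ℝ} {H : ℝ} (hcH : c ≤ H)
    (hy : ∀ r ∈ Set.Icc a b, y r ∈ Set.Icc 0 H)
    (hdrop : ∀ u ∈ Set.Icc a b, ∀ r ∈ Set.Icc a b, u ≤ r → y u - y r ≤ c)
    (hxy : ∀ u ∈ Set.Icc a b, ∀ r ∈ Set.Icc a b, |x r - x u| = |y r - y u|) :
    PartitionBound x c a b (H - c) := by
  suffices key : ∀ e v, PartitionSum x c a e v → e ≤ b →
      ∃ F ≤ H, v ≤ F - c ∧ ∀ r ∈ Set.Icc e b, F ≤ y r + c by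
    intro v hv
    obtain ⟨F, h₁, h₂, -⟩ := key b v hv le_rfl
    linarith
  intro e v hv
  induction hv with
  | refl => exact fun _ => ⟨c, hcH, by simp, fun r hr => by linarith [(hy r hr).1]⟩
  | @snoc f e v hf hfe ih =>
    intro heb
    obtain ⟨F, hFH, hvF, hF⟩ := ih (hfe.trans heb)
    have hfm : f ∈ Set.Icc a b := ⟨hf.le, hfe.trans heb⟩
    have hem : e ∈ Set.Icc a b := ⟨hf.le.trans hfe, heb⟩
    have hd := hdrop f hfm e hem hfe
    rw [hxy f hfm e hem]
    rcases le_or_gt (|y e - y f| - c) 0 with h | h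
    · exact ⟨F, hFH, by rw [max_eq_right h]; linarith, fun r hr => hF r ⟨hfe.trans hr.1, hr.2⟩⟩
    · refine ⟨y e, (hy e hem).2, ?_, fun r hr => ?_⟩
      · have hlt : y f < y e := by
          by_contra! hle
          rw [abs_of_nonpos (by linarith)] at h
          linarith
        rw [max_eq_left h.le, abs_of_pos (by linarith)]
        linarith [hF f ⟨le_rfl, hfm.2⟩]
      · linarith [hdrop e hem r ⟨hem.1.trans hr.1, hr.2⟩ hr.1]

end PartitionBound

theorem partitionSum_iff {x : ℝ → ℝ} {c a b v : ℝ} :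
    PartitionSum x c a b v ↔ ∃ (m : ℕ) (u : ℕ → ℝ), u 0 = a ∧ u m = b ∧
      (∀ i, i < m → u i ≤ u (i + 1)) ∧
      v = ∑ i ∈ Finset.range m, max (|x (u (i + 1)) - x (u i)| - c) 0 := by
  constructor
  · intro h
    induction h with
    | refl => exact ⟨0, fun _ => a, by simp⟩
    | @snoc b d v _ hbd ih =>
      obtain ⟨m, u, h0, hm, hmono, rfl⟩ := ih
      have hu : ∀ i ≤ m, Function.update u (m + 1) d i = u i := fun i hi =>
        Function.update_of_ne (by omega) _ _
      refine ⟨m + 1, Function.update u (m + 1) d, ?_, by simp, fun i hi => ?_, ?_⟩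
      · rw [hu 0 (by omega), h0]
      · rcases (Nat.lt_succ_iff.mp hi).lt_or_eq with h | rfl
        · rw [hu i (by omega), hu (i + 1) (by omega)]
          exact hmono i h
        · rw [hu i le_rfl, hm]
          simpa using hbd
      · rw [Finset.sum_range_succ, hu m le_rfl, hm, Function.update_self]
        congr 1
        refine Finset.sum_congr rfl fun i hi => ?_
        have := Finset.mem_range.mp hi
        rw [hu i (by omega), hu (i + 1) (by omega)]
  · rintro ⟨m, u, rfl, rfl, hmono, rfl⟩
    induction m with
    | zero => simpa using PartitionSum.refl
    | succ m ih =>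
      rw [Finset.sum_range_succ]
      exact (ih fun i hi => hmono i (by omega)).snoc (hmono m (by omega))

theorem abs_truncVar_sub_le {x : ℝ → ℝ} {c a b g E v : ℝ} (hv : PartitionSum x c a b v)
    (hgv : g - E ≤ v) (hV : PartitionBound x c a b (g + E)) : |truncVar x c a b - g| ≤ E := by
  have hset : truncVar x c a b = sSup {v | PartitionSum x c a b v} := by
    simp only [truncVar, partitionSum_iff]
  have h1 : v ≤ truncVar x c a b := hset ▸ le_csSup ⟨_, hV⟩ hv
  have h2 : truncVar x c a b ≤ g + E := hset ▸ csSup_le ⟨v, hv⟩ hV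
  rw [abs_le]
  constructor <;> linarith

/-! ### Lower bounds along monotone runs -/

/-- `v` is at most a truncated variation sum of `x` on `[a,b]` whose last interval is counted as a
move in direction `ε`. -/
def RunSum (x : ℝ → ℝ) (c a b ε v : ℝ) : Prop :=
  ∃ j w, PartitionSum x c a j w ∧ j ≤ b ∧ v ≤ w + ε * (x b - x j) - c

namespace RunSum

variable {x : ℝ → ℝ} {c a b d ε v w : ℝ}

theorem start : RunSum x c a a ε (-c) := ⟨a, 0, .refl, le_rfl, by simp⟩

theorem mono (h : RunSum x c a b ε v) (hw : w ≤ v) : RunSum x c a b ε w := by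
  obtain ⟨j, w', h, hj, hv⟩ := h
  exact ⟨j, w', h, hj, hw.trans hv⟩

theorem extend (h : RunSum x c a b ε v) (hbd : b ≤ d) :
    RunSum x c a d ε (v + ε * (x d - x b)) := by
  obtain ⟨j, w, h, hj, hv⟩ := h
  exact ⟨j, w, h, hj.trans hbd, by linarith⟩

theorem exists_partitionSum (h : RunSum x c a b ε v) (hε : |ε| = 1) :
    ∃ w, PartitionSum x c a b w ∧ v ≤ w := by
  obtain ⟨j, w, h, hj, hv⟩ := h
  refine ⟨_, h.snoc hj, ?_⟩
  have h1 := le_max_left (|x b - x j| - c) 0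
  have h2 := le_abs_self (ε * (x b - x j))
  rw [abs_mul, hε, one_mul] at h2
  linarith

theorem turn (h : RunSum x c a b ε v) (hε : |ε| = 1) : RunSum x c a b (-ε) (v - c) := by
  obtain ⟨w, hw, hv⟩ := h.exists_partitionSum hε
  exact ⟨b, w, hw, le_rfl, by simpa using hv⟩

end RunSum

/-! ### Affine copies of the curve -/

/-- On `[b, b + l]` the function `x` is an affine image of its restriction to `[0,1]`. -/
def IsCopy (x : ℝ → ℝ) (b l A h : ℝ) : Prop :=
  ∀ s ∈ Set.Icc (0 : ℝ) 1, x (b + l * s) = A + h * x s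

/-- The asymptotic value of the truncated variation, with parameter `c ∈ [H / 3 ^ (m + 1), H / 3 ^ m]`,
of a copy of the curve of height `H`. -/
def gain (c H : ℝ) (m : ℕ) : ℝ := 3 ^ m * H - c * (3 / 4) * (9 ^ m - 1)

theorem gain_zero (c H : ℝ) : gain c H 0 = H := by simp [gain]

theorem gain_succ (c H : ℝ) (m : ℕ) : gain c H (m + 1) = 9 * gain c (H / 3) m - 6 * c := by
  simp only [gain, pow_succ]
  ring

theorem third_endpoints (b l : ℝ) (i : Fin 3) :
    b + l * ((i : ℕ) / 3) = b + l * ((3 * (i : ℕ) + ((0 : Fin 3) : ℕ)) / 9) ∧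
    b + l * ((3 * (i : ℕ) + ((0 : Fin 3) : ℕ)) / 9) + l / 9 =
      b + l * ((3 * (i : ℕ) + ((1 : Fin 3) : ℕ)) / 9) ∧
    b + l * ((3 * (i : ℕ) + ((1 : Fin 3) : ℕ)) / 9) + l / 9 =
      b + l * ((3 * (i : ℕ) + ((2 : Fin 3) : ℕ)) / 9) ∧
    b + l * ((3 * (i : ℕ) + ((2 : Fin 3) : ℕ)) / 9) + l / 9 = b + l * (((i : ℕ) + 1) / 3) := by
  simp only [Fin.val_zero, Fin.val_one, Fin.val_two]
  push_cast
  refine ⟨?_, ?_, ?_, ?_⟩ <;> ring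

namespace IsCopy

variable {x : ℝ → ℝ} {b l A h c : ℝ}

theorem block (hx : IsPeanoX x) (H : IsCopy x b l A h) (i j : Fin 3) :
    IsCopy x (b + l * ((3 * (i : ℕ) + (j : ℕ)) / 9)) (l / 9)
      (A + h * ((i : ℕ) + if j = 1 then 1 else 0) / 3) ((if j = 1 then -h else h) / 3) := by
  intro s hs
  have hi : (i : ℕ) ≤ (2 : ℝ) := by exact_mod_cast Fin.is_le i
  have hj : (j : ℕ) ≤ (2 : ℝ) := by exact_mod_cast Fin.is_le j
  have h0 : (0 : ℝ) ≤ (i : ℕ) := by positivity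
  have h0' : (0 : ℝ) ≤ (j : ℕ) := by positivity
  obtain ⟨h1, h2⟩ := hs
  have := H ((3 * (i : ℕ) + (j : ℕ) + s) / 9) ⟨by positivity, by linarith⟩
  rw [hx.apply_block i j ⟨h1, h2⟩] at this
  convert this using 1
  · ring_nf
  · split_ifs <;> ring

theorem exists_block_eq (hx : IsPeanoX x) (H : IsCopy x b l A h) {k : ℕ} (hk : k < 9) :
    ∃ A' h', |h'| = |h| / 3 ∧ IsCopy x (b + l * (k / 9)) (l / 9) A' h' := by
  have := H.block hx ⟨k / 3, by omega⟩ ⟨k % 3, by omega⟩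
  have e : 3 * ((k / 3 : ℕ) : ℝ) + ((k % 3 : ℕ) : ℝ) = k := by exact_mod_cast Nat.div_add_mod k 3
  simp only [e] at this
  refine ⟨_, _, ?_, this⟩
  split_ifs <;> simp [abs_div]

theorem apply_start (hx : IsPeanoX x) (H : IsCopy x b l A h) : x b = A := by
  simpa [hx.apply_zero] using H 0 (by simp)

theorem apply_end (hx : IsPeanoX x) (H : IsCopy x b l A h) : x (b + l) = A + h := by
  simpa [hx.apply_one] using H 1 (by simp)

theorem runSum (hx : IsPeanoX x) (hl : 0 ≤ l) (m : ℕ) {a ε v : ℝ} (hε : |ε| = 1)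
    (H : IsCopy x b l A h) (hv : RunSum x c a b ε v) :
    RunSum x c a (b + l) ε (v + gain c (ε * h) m) := by
  induction m generalizing b l A h ε v with
  | zero =>
    have := hv.extend (d := b + l) (by linarith)
    rwa [H.apply_start hx, H.apply_end hx, add_sub_cancel_left, ← gain_zero c (ε * h)] at this
  | succ m ih =>
    have third : ∀ (i : Fin 3) {v : ℝ}, RunSum x c a (b + l * ((i : ℕ) / 3)) ε v →
        RunSum x c a (b + l * (((i : ℕ) + 1) / 3)) ε
          (v + 3 * gain c (ε * h / 3) m - 2 * c) := by
      intro i v hv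
      have hε' : |-ε| = 1 := by rwa [abs_neg]
      have hl' : 0 ≤ l / 9 := by positivity
      obtain ⟨e0, e1, e2, e3⟩ := third_endpoints b l i
      rw [e0] at hv
      have s0 := ih hl' hε (H.block hx i 0) hv
      rw [e1] at s0
      have s1 := ih hl' hε' (H.block hx i 1) (s0.turn hε)
      rw [e2] at s1
      have s2 := ih hl' (by rwa [neg_neg]) (H.block hx i 2) (s1.turn hε')
      rw [e3, neg_neg] at s2
      refine s2.mono (le_of_eq ?_)
      rw [if_neg (by decide), if_pos rfl, if_neg (by decide),
        show -ε * (-h / 3) = ε * h / 3 by ring, ← mul_div_assoc]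
      ring
    have t0 := third 0 (by simpa using hv)
    have t1 := third 1 (by simpa using t0)
    have t2 := third 2 (by convert t1 using 2; norm_num)
    convert t2 using 1
    · norm_num
    · rw [gain_succ]; ring

theorem exists_partitionSum_ge (hx : IsPeanoX x) (hl : 0 ≤ l) (m : ℕ) (H : IsCopy x b l A h) :
    ∃ v, PartitionSum x c b (b + l) v ∧ gain c |h| m - c ≤ v := by
  obtain ⟨ε, hε, hεh⟩ : ∃ ε : ℝ, |ε| = 1 ∧ ε * h = |h| := by
    rcases le_total 0 h with hh | hh
    · exact ⟨1, by simp, by rw [abs_of_nonneg hh, one_mul]⟩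
    · exact ⟨-1, by simp, by rw [abs_of_nonpos hh]; ring⟩
  obtain ⟨v, hv, hle⟩ := (H.runSum hx hl m hε (c := c) RunSum.start).exists_partitionSum hε
  exact ⟨v, hv, by rw [hεh] at hle; linarith⟩

theorem partitionBound_of_third_le (hx : IsPeanoX x) (hl : 0 < l) (H : IsCopy x b l A h)
    (h₁ : |h| / 3 ≤ c) (h₂ : c ≤ |h|) : PartitionBound x c b (b + l) (|h| - c) := by
  obtain ⟨ε, hε, hεh⟩ : ∃ ε : ℝ, |ε| = 1 ∧ ε * h = |h| := by
    rcases le_total 0 h with hh | hh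
    · exact ⟨1, by simp, by rw [abs_of_nonneg hh, one_mul]⟩
    · exact ⟨-1, by simp, by rw [abs_of_nonpos hh]; ring⟩
  have hy : ∀ r ∈ Set.Icc b (b + l), ∃ s ∈ Set.Icc (0 : ℝ) 1, r = b + l * s ∧
      ε * (x r - A) = |h| * x s := by
    rintro r ⟨hr₁, hr₂⟩
    have hs : (r - b) / l ∈ Set.Icc (0 : ℝ) 1 :=
      ⟨div_nonneg (by linarith) hl.le, (div_le_one hl).mpr (by linarith)⟩
    have hr : r = b + l * ((r - b) / l) := by field_simp; ring
    refine ⟨_, hs, hr, ?_⟩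
    have := H _ hs
    rw [← hr] at this
    rw [this, ← hεh]
    ring
  refine PartitionBound.of_drop_le (y := fun r => ε * (x r - A)) h₂ ?_ ?_ ?_
  · intro r hr
    obtain ⟨s, hs, -, hxs⟩ := hy r hr
    obtain ⟨h0, h1⟩ := hx.mem_Icc hs
    simp only [hxs]
    exact ⟨by positivity, mul_le_of_le_one_right (abs_nonneg _) h1⟩
  · intro u hu r hr hur
    obtain ⟨s, hs, hus, hxs⟩ := hy u hu
    obtain ⟨s', hs', hrs, hxs'⟩ := hy r hr
    have hss : s ≤ s' := le_of_mul_le_mul_left (by linarith) hl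
    have := mul_le_mul_of_nonneg_left (hx.sub_le_third hs.1 hss hs'.2) (abs_nonneg h)
    simp only [hxs, hxs']
    linarith
  · intro u _ r _
    rw [← mul_sub, abs_mul, hε, one_mul]
    ring_nf

theorem mul_sub_nonneg (hx : IsPeanoX x) (hl : 0 < l) (H : IsCopy x b l A h) (i : Fin 3)
    {q r u : ℝ} (hq : x q = A + h * ((i : ℕ) / 3) ∨ x q = A + h * (((i : ℕ) + 1) / 3))
    (hr : r ∈ Set.Icc (b + l * ((i : ℕ) / 3)) (b + l * (((i : ℕ) + 1) / 3)))
    (hu : u ∈ Set.Icc (b + l * ((i : ℕ) / 3)) (b + l * (((i : ℕ) + 1) / 3))) :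
    0 ≤ (x q - x r) * (x q - x u) := by
  have hy : ∀ r ∈ Set.Icc (b + l * (((i : ℕ) : ℝ) / 3)) (b + l * (((i : ℕ) + 1) / 3)),
      ∃ y ∈ Set.Icc (((i : ℕ) : ℝ) / 3) (((i : ℕ) + 1) / 3), x r = A + h * y := by
    rintro r ⟨hr₁, hr₂⟩
    have hi : (i : ℕ) ≤ (2 : ℝ) := by exact_mod_cast Fin.is_le i
    have h0 : (0 : ℝ) ≤ (i : ℕ) := by positivity
    have hs : (r - b) / l ∈ Set.Icc (((i : ℕ) : ℝ) / 3) (((i : ℕ) + 1) / 3) :=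
      ⟨(le_div_iff₀ hl).mpr (by linarith), (div_le_iff₀ hl).mpr (by linarith)⟩
    have hr : r = b + l * ((r - b) / l) := by field_simp; ring
    refine ⟨_, hx.mem_third i.isLt hs, ?_⟩
    have := H ((r - b) / l) ⟨le_trans (by positivity) hs.1, hs.2.trans (by linarith)⟩
    rwa [← hr] at this
  obtain ⟨y, ⟨hy₁, hy₂⟩, hxr⟩ := hy r hr
  obtain ⟨z, ⟨hz₁, hz₂⟩, hxu⟩ := hy u hu
  rcases hq with hq | hq
  · have : 0 ≤ h ^ 2 * ((y - (i : ℕ) / 3) * (z - (i : ℕ) / 3)) :=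
      mul_nonneg (sq_nonneg _) (mul_nonneg (by linarith) (by linarith))
    rw [hq, hxr, hxu]
    linarith
  · have : 0 ≤ h ^ 2 * ((((i : ℕ) + 1) / 3 - y) * (((i : ℕ) + 1) / 3 - z)) :=
      mul_nonneg (sq_nonneg _) (mul_nonneg (by linarith) (by linarith))
    rw [hq, hxr, hxu]
    linarith

theorem partitionBound (hx : IsPeanoX x) (hc : 0 ≤ c) (hl : 0 < l) (m : ℕ) (H : IsCopy x b l A h)
    (h₁ : |h| / 3 ^ (m + 1) ≤ c) (h₂ : c ≤ |h| / 3 ^ m) :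
    PartitionBound x c b (b + l) (gain c |h| m - c) := by
  induction m generalizing b l A h with
  | zero =>
    rw [gain_zero]
    exact H.partitionBound_of_third_le hx hl (by simpa using h₁) (by simpa using h₂)
  | succ m ih =>
    have blk : ∀ i j : Fin 3, PartitionBound x c (b + l * ((3 * (i : ℕ) + (j : ℕ)) / 9))
        (b + l * ((3 * (i : ℕ) + (j : ℕ)) / 9) + l / 9) (gain c (|h| / 3) m - c) := by
      intro i j
      have habs : |(if j = 1 then -h else h) / 3| = |h| / 3 := by
        split_ifs <;> simp [abs_div]
      have := ih (by positivity) (H.block hx i j)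
        (by rw [habs, div_div, ← pow_succ']; exact h₁) (by rw [habs, div_div, ← pow_succ']; exact h₂)
      rwa [habs] at this
    have third : ∀ i : Fin 3, PartitionBound x c (b + l * ((i : ℕ) / 3))
        (b + l * (((i : ℕ) + 1) / 3)) (3 * (gain c (|h| / 3) m - c)) := by
      intro i
      obtain ⟨e0, e1, e2, e3⟩ := third_endpoints b l i
      have p0 := blk i 0
      have p1 := blk i 1
      have p2 := blk i 2
      have v1 := (H.block hx i 1).apply_start hx
      have v2 := (H.block hx i 2).apply_start hx
      rw [e1] at p0
      rw [e2] at p1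
      rw [e3] at p2
      rw [← e0] at p0
      have hl' : 0 < l / 9 := by positivity
      have q := p1.trans_of_extremum (by linarith) (by linarith) (fun u hu r hr =>
        H.mul_sub_nonneg hx hl i (.inl (by
            have : (2 : Fin 3) ≠ 1 := by decide
            rw [v2, if_neg this]; ring))
          ⟨by linarith [hu.1], by linarith [hu.2]⟩ ⟨by linarith [hr.1], hr.2⟩) p2
      have := p0.trans_of_extremum (by linarith) (by linarith) (fun u hu r hr =>
        H.mul_sub_nonneg hx hl i (.inr (by rw [v1, if_pos rfl]; ring))
          ⟨by linarith [hu.1], by linarith [hu.2]⟩ ⟨by linarith [hr.1], hr.2⟩) q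
      exact this.mono (by linarith)
    have t0 := third 0
    have t1 := third 1
    have t2 := third 2
    norm_num at t0 t1 t2
    have := (t0.trans hc (by linarith) (by linarith) t1).trans hc (by linarith) (by linarith) t2
    exact this.mono (by rw [gain_succ]; linarith)

theorem partitionBound_initial (hx : IsPeanoX x) (hc : 0 ≤ c) (hl : 0 < l) (m : ℕ)
    (H : IsCopy x b l A h) (h₁ : |h| / 3 ^ (m + 2) ≤ c) (h₂ : c ≤ |h| / 3 ^ (m + 1)) {k : ℕ}
    (hk : k ≤ 9) : PartitionBound x c b (b + l * (k / 9)) (k * gain c (|h| / 3) m) := by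
  induction k with
  | zero => simpa using PartitionBound.self hc
  | succ k ih =>
    obtain ⟨A', h', hh', hcopy⟩ := H.exists_block_eq hx (k := k) (by omega)
    have h3 := hcopy.partitionBound hx hc (by positivity) m
      (by rw [hh', div_div, ← pow_succ']; exact h₁) (by rw [hh', div_div, ← pow_succ']; exact h₂)
    rw [hh', show b + l * (k / 9) + l / 9 = b + l * ((k + 1 : ℕ) / 9) by push_cast; ring] at h3
    refine ((ih (by omega)).trans hc ?_ ?_ h3).mono (le_of_eq ?_)
    · have : 0 ≤ l * (k / 9) := by positivity
      linarith
    · push_cast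
      linarith
    · push_cast
      ring

theorem exists_partitionSum_initial (hx : IsPeanoX x) (hl : 0 < l) (m : ℕ)
    (H : IsCopy x b l A h) {k : ℕ} (hk : k ≤ 9) :
    ∃ v, PartitionSum x c b (b + l * (k / 9)) v ∧ k * (gain c (|h| / 3) m - c) ≤ v := by
  induction k with
  | zero => exact ⟨0, by simpa using PartitionSum.refl, by simp⟩
  | succ k ih =>
    obtain ⟨v, hv, hle⟩ := ih (by omega)
    obtain ⟨A', h', hh', hcopy⟩ := H.exists_block_eq hx (k := k) (by omega)
    obtain ⟨w, hw, hle'⟩ := hcopy.exists_partitionSum_ge (c := c) hx (by positivity) m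
    rw [hh'] at hle'
    rw [show b + l * (k / 9) + l / 9 = b + l * ((k + 1 : ℕ) / 9) by push_cast; ring] at hw
    exact ⟨_, hv.trans hw, by push_cast; linarith⟩

theorem exists_eq_add_div_nine {s : ℝ} (hs : s ∈ Set.Icc (0 : ℝ) 1) :
    ∃ k : ℕ, k < 9 ∧ ∃ r ∈ Set.Icc (0 : ℝ) 1, s = (k + r) / 9 := by
  obtain ⟨i, j, r, hr, rfl⟩ := IsPeanoX.exists_block hs
  exact ⟨3 * i + j, by omega, r, hr, by push_cast; ring⟩

theorem partitionBound_and_exists (hx : IsPeanoX x) (hc : 0 ≤ c) (hl : 0 < l) (m : ℕ)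
    (H : IsCopy x b l A h) (h₁ : |h| / 3 ^ (m + 1) ≤ c) (h₂ : c ≤ |h| / 3 ^ m) {s : ℝ}
    (hs : s ∈ Set.Icc (0 : ℝ) 1) :
    PartitionBound x c b (b + l * s) (s * gain c |h| m + (8 * m + 3) * c) ∧
      ∃ v, PartitionSum x c b (b + l * s) v ∧ s * gain c |h| m - (8 * m + 3) * c ≤ v := by
  induction m generalizing b l A h s with
  | zero =>
    simp only [zero_add, pow_one, pow_zero, div_one] at h₁ h₂
    have hls : l * s ≤ l := mul_le_of_le_one_right hl.le hs.2
    have hls' : 0 ≤ l * s := mul_nonneg hl.le hs.1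
    have hsh : 0 ≤ s * |h| := mul_nonneg hs.1 (abs_nonneg h)
    have hsh' : s * |h| ≤ |h| := mul_le_of_le_one_left (abs_nonneg h) hs.2
    rw [gain_zero]
    norm_num
    refine ⟨((H.partitionBound_of_third_le hx hl h₁ h₂).mono_right (by linarith)).mono
      (by linarith), _, .single (by linarith), ?_⟩
    have := le_max_right (|x (b + l * s) - x b| - c) 0
    linarith
  | succ m ih =>
    obtain ⟨k, hk, r, hr, rfl⟩ := exists_eq_add_div_nine hs
    obtain ⟨A', h', hh', hcopy⟩ := H.exists_block_eq hx hk
    have hlk : 0 ≤ l * (k / 9) := by positivity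
    have hlr : 0 ≤ l / 9 * r := mul_nonneg (by positivity) hr.1
    obtain ⟨hV, v, hv, hle⟩ := ih (by positivity) hcopy
      (by rw [hh', div_div, ← pow_succ']; exact h₁)
      (by rw [hh', div_div, ← pow_succ']; exact h₂) hr
    obtain ⟨w, hw, hle'⟩ := H.exists_partitionSum_initial (c := c) hx hl m hk.le
    have hW := H.partitionBound_initial hx hc hl m h₁ h₂ hk.le
    have e : b + l * (k / 9) + l / 9 * r = b + l * ((k + r) / 9) := by ring
    rw [e, hh'] at hV
    rw [e] at hv
    rw [hh'] at hle
    have hkc : k * c ≤ 8 * c :=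
      mul_le_mul_of_nonneg_right (by exact_mod_cast Nat.le_of_lt_succ hk) hc
    have hs' : 0 ≤ (k + r) / 9 * c := mul_nonneg hs.1 hc
    have hs'' : (k + r) / 9 * c ≤ c := mul_le_of_le_one_left hc hs.2
    rw [gain_succ]
    push_cast
    exact ⟨(hW.trans hc (by linarith) (by linarith) hV).mono (by linarith),
      _, hw.trans hv, by linarith⟩

end IsCopy

theorem IsPeanoX.isCopy {x : ℝ → ℝ} : IsCopy x 0 1 0 1 := fun s _ => by simp

theorem IsPeanoX.abs_truncVar_sub_le {x : ℝ → ℝ} (hx : IsPeanoX x) {c t : ℝ} (m : ℕ)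
    (h₁ : 1 / 3 ^ (m + 1) ≤ c) (h₂ : c ≤ 1 / 3 ^ m) (ht : t ∈ Set.Icc (0 : ℝ) 1) :
    |truncVar x c 0 t - t * gain c 1 m| ≤ (8 * m + 3) * c := by
  have hc : 0 ≤ c := le_trans (by positivity) h₁
  have := (IsPeanoX.isCopy (x := x)).partitionBound_and_exists hx hc one_pos m
    (by simpa using h₁) (by simpa using h₂) ht
  simp only [zero_add, one_mul, abs_one] at this
  obtain ⟨hV, v, hv, hle⟩ := this
  exact _root_.abs_truncVar_sub_le hv hle hV

/-- The limit holds for every positive truncation scale `p`. -/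
theorem IsPeanoX.tendsto_truncVar {x : ℝ → ℝ} (hx : IsPeanoX x) {p t : ℝ} (hp : 0 < p)
    (ht : t ∈ Set.Icc (0 : ℝ) 1) :
    Tendsto (fun n : ℕ => p / 3 ^ n * truncVar x (p / 3 ^ n) 0 t) atTop
      (nhds ((3 : ℝ) ^ (⌊-Real.logb 3 p⌋) * p *
        (1 - 3 / 4 * ((3 : ℝ) ^ (⌊-Real.logb 3 p⌋) * p)) * t)) := by
  set f := ⌊-Real.logb 3 p⌋ with hf
  set w := (3 : ℝ) ^ f * p with hw
  have hpl : (3 : ℝ) ^ (-Real.logb 3 p) = p⁻¹ := by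
    rw [Real.rpow_neg (by norm_num), Real.rpow_logb (by norm_num) (by norm_num) hp]
  have hw1 : w ≤ 1 := by
    have : (3 : ℝ) ^ f ≤ p⁻¹ := by
      rw [← hpl, ← Real.rpow_intCast]
      exact Real.rpow_le_rpow_of_exponent_le (by norm_num) (Int.floor_le _)
    calc w ≤ p⁻¹ * p := mul_le_mul_of_nonneg_right this hp.le
      _ = 1 := inv_mul_cancel₀ hp.ne'
  have hw3 : 1 / 3 ≤ w := by
    have : p⁻¹ ≤ (3 : ℝ) ^ (f + 1) := by
      rw [← hpl, ← Real.rpow_intCast]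
      refine Real.rpow_le_rpow_of_exponent_le (by norm_num) ?_
      push_cast
      exact (Int.lt_floor_add_one _).le
    rw [zpow_add_one₀ (by norm_num)] at this
    have := mul_le_mul_of_nonneg_right this hp.le
    rw [inv_mul_cancel₀ hp.ne'] at this
    linarith
  have hw0 : 0 < w := by linarith
  obtain ⟨N, hN⟩ : ∃ N : ℕ, -f ≤ N := ⟨(-f).toNat, Int.self_le_toNat _⟩
  have hM : ∀ n ≥ N, ((n + f).toNat : ℤ) = n + f := fun n hn => Int.toNat_of_nonneg (by omega)
  have hMtop : Tendsto (fun n : ℕ => ((n : ℤ) + f).toNat) atTop atTop := by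
    refine tendsto_atTop.mpr fun K => ?_
    filter_upwards [eventually_ge_atTop (K + f.natAbs)] with n hn
    omega
  have hcw : ∀ n ≥ N, p / 3 ^ n = w / 3 ^ ((n : ℤ) + f).toNat := by
    intro n hn
    rw [hw, ← zpow_natCast (3 : ℝ) ((n : ℤ) + f).toNat, hM n hn, zpow_add₀ (by norm_num),
      zpow_natCast]
    field_simp
  suffices key : Tendsto (fun m : ℕ => w / 3 ^ m * truncVar x (w / 3 ^ m) 0 t) atTop
      (nhds (w * (1 - 3 / 4 * w) * t)) by
    refine (key.comp hMtop).congr' ?_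
    filter_upwards [eventually_ge_atTop N] with n hn
    simp only [Function.comp_apply, hcw n hn]
  have hgain : ∀ m : ℕ, w / 3 ^ m * (t * gain (w / 3 ^ m) 1 m) =
      w * (1 - 3 / 4 * w) * t + 3 / 4 * w ^ 2 * t * (1 / 9) ^ m := by
    intro m
    rw [gain, show (9 : ℝ) = 3 ^ 2 by norm_num, one_div_pow, ← pow_mul, mul_comm 2 m, pow_mul]
    field_simp
    ring
  have h9 : Tendsto (fun m : ℕ => (1 / 9 : ℝ) ^ m) atTop (nhds 0) :=
    tendsto_pow_atTop_nhds_zero_of_lt_one (by norm_num) (by norm_num)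
  have hm9 : Tendsto (fun m : ℕ => (m : ℝ) * (1 / 9 : ℝ) ^ m) atTop (nhds 0) :=
    tendsto_self_mul_const_pow_of_lt_one (by norm_num) (by norm_num)
  have hmain : Tendsto (fun m : ℕ => w / 3 ^ m * (t * gain (w / 3 ^ m) 1 m)) atTop
      (nhds (w * (1 - 3 / 4 * w) * t)) := by
    simp only [hgain]
    simpa using (h9.const_mul (3 / 4 * w ^ 2 * t)).const_add (w * (1 - 3 / 4 * w) * t)
  have herr : Tendsto (fun m : ℕ => w ^ 2 * (8 * (m * (1 / 9 : ℝ) ^ m) + 3 * (1 / 9 : ℝ) ^ m))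
      atTop (nhds 0) := by
    simpa using ((hm9.const_mul 8).add (h9.const_mul 3)).const_mul (w ^ 2)
  have hdiff : Tendsto (fun m : ℕ => w / 3 ^ m * truncVar x (w / 3 ^ m) 0 t -
      w / 3 ^ m * (t * gain (w / 3 ^ m) 1 m)) atTop (nhds 0) := by
    refine squeeze_zero_norm (fun m => ?_) herr
    have hc : 0 ≤ w / 3 ^ m := by positivity
    have h := hx.abs_truncVar_sub_le (c := w / 3 ^ m) m
      (by rw [pow_succ', ← div_div]; gcongr) (by gcongr) ht
    rw [← mul_sub, Real.norm_eq_abs, abs_mul, abs_of_nonneg hc]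
    refine (mul_le_mul_of_nonneg_left h hc).trans (le_of_eq ?_)
    rw [show (9 : ℝ) = 3 ^ 2 by norm_num, one_div_pow, ← pow_mul, mul_comm 2 m, pow_mul]
    field_simp
  simpa using hdiff.add hmain

/-- Convergence of the normalized truncated variations of the horizontal component of the
Peano curve: `3^{-n} p · TV^{3^{-n} p}(x,[0,t]) → C_p t`. -/
theorem peano_truncated_variation_limit (x : ℝ → ℝ) (hx : IsPeanoX x)
    (p' q' : ℕ) (hp'pos : 0 < p') (hq'pos : 0 < q')
    (hp'3 : ¬ (3 ∣ p')) (hq'3 : ¬ (3 ∣ q'))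
    (p : ℝ) (hp : p = (p' : ℝ) / (q' : ℝ))
    (t : ℝ) (ht : t ∈ Set.Icc (0 : ℝ) 1) :
    Filter.Tendsto (fun n : ℕ => p / 3 ^ n * truncVar x (p / 3 ^ n) 0 t) Filter.atTop
      (nhds ((3 : ℝ) ^ (⌊-Real.logb 3 p⌋) * p *
        (1 - 3 / 4 * ((3 : ℝ) ^ (⌊-Real.logb 3 p⌋) * p)) * t)) := by
  subst hp
  exact hx.tendsto_truncVar (by positivity) ht
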